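/- Let d ≥ 1 be an integer, γ > 0 a real number, and let C ⊆ ℝ^d be a finite set with |C| > 24·d·log₂(d+1). Then there exists y ∈ C such that: for every affine function ℓ : ℝ^d → ℝ satisfying |ℓ(x) − ℓ(x')| ≤ γ/d for all x, x' ∈ C∖{y} and ℓ(x) ≥ γ for all x ∈ C∖{y}, one has ℓ(y) ≥ γ/2; and for every affine function ℓ satisfying |ℓ(x) − ℓ(x')| ≤ γ/d for all x, x' ∈ C∖{y} and ℓ(x) ≤ −γ for all x ∈ C∖{y}, one has ℓ(y) ≤ −γ/2. -/

import Mathlib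

/-- An affine map sends an affine dependence to a dependence with the same coefficients. -/
theorem AffineMap.sum_mul_eq_zero_of_affine_dependence {V : Type*} [AddCommGroup V] [Module ℝ V]
    (ℓ : V →ᵃ[ℝ] ℝ) {T : Finset V} {f : V → ℝ} (hfx : ∑ x ∈ T, f x • x = 0)
    (hf : ∑ x ∈ T, f x = 0) : ∑ x ∈ T, f x * ℓ x = 0 := by
  have hdecomp : ∀ x, ℓ x = ℓ.linear x + ℓ 0 := fun x => congrFun ℓ.decomp x
  have hlin : ∑ x ∈ T, f x * ℓ.linear x = 0 := by
    simpa only [map_sum, map_smul, smul_eq_mul, map_zero] using congrArg ℓ.linear hfx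
  calc ∑ x ∈ T, f x * ℓ x = ∑ x ∈ T, (f x * ℓ.linear x + f x * ℓ 0) :=
        Finset.sum_congr rfl fun x _ => by rw [hdecomp x, mul_add]
    _ = 0 := by rw [Finset.sum_add_distrib, hlin, ← Finset.sum_mul, hf, zero_mul, zero_add]

/-- If `b` is a combination of the values of `g` on `S` with coefficients in `[-1, 1]` that sum to
`1`, and `g` oscillates by at most `δ` on `S`, then `b` is at least a lower bound of `g` minus
`(#S - 1) * δ / 2`. -/
theorem Finset.sub_le_sum_mul_of_abs_le_one {α : Type*} {S : Finset α} {a g : α → ℝ} {δ c : ℝ}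
    (ha : ∀ x ∈ S, |a x| ≤ 1) (hsum : ∑ x ∈ S, a x = 1)
    (hosc : ∀ x ∈ S, ∀ x' ∈ S, |g x - g x'| ≤ δ) (hc : ∀ x ∈ S, c ≤ g x) :
    c - ((S.card : ℝ) - 1) * δ / 2 ≤ ∑ x ∈ S, a x * g x := by
  have hne : S.Nonempty := Finset.nonempty_of_sum_ne_zero (by rw [hsum]; exact one_ne_zero)
  obtain ⟨z, hz, hmin⟩ := S.exists_min_image g hne
  have hterm : ∀ x ∈ S, δ / 2 * (a x - 1) ≤ a x * (g x - g z) := by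
    intro x hx
    obtain ⟨h1, h2⟩ := abs_le.mp (ha x hx)
    have h3 := (abs_le.mp (hosc x hx z hz)).2
    have h4 := hmin x hx
    nlinarith [mul_nonneg (sub_nonneg.2 h2) (sub_nonneg.2 h3),
      mul_nonneg (neg_le_iff_add_nonneg.1 h1) (sub_nonneg.2 h4)]
  have h := Finset.sum_le_sum hterm
  simp only [mul_sub, Finset.sum_sub_distrib, ← Finset.mul_sum, ← Finset.sum_mul, hsum,
    Finset.sum_const, nsmul_eq_mul] at h
  linarith [hc z hz]


/-- In any finite set `C ⊆ ℝ^d` with `|C| > 24·d·log₂(d+1)` there is a point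
`y ∈ C` whose sign is inferred by the remaining points, for every affine function under
which `C∖{y}` is a `γ/d`-cluster with margin `γ`. -/
theorem cluster_inference_sign (d : ℕ) (hd : 1 ≤ d) (γ : ℝ) (hγ : 0 < γ)
    (C : Finset (EuclideanSpace ℝ (Fin d)))
    (hcard : (24 : ℝ) * d * Real.logb 2 (d + 1) < C.card) :
    letI : DecidableEq (EuclideanSpace ℝ (Fin d)) := Classical.decEq _
    ∃ y ∈ C,
      (∀ ℓ : EuclideanSpace ℝ (Fin d) →ᵃ[ℝ] ℝ,
        (∀ x ∈ C.erase y, ∀ x' ∈ C.erase y, |ℓ x - ℓ x'| ≤ γ / d) →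
        (∀ x ∈ C.erase y, γ ≤ ℓ x) →
        γ / 2 ≤ ℓ y) ∧
      (∀ ℓ : EuclideanSpace ℝ (Fin d) →ᵃ[ℝ] ℝ,
        (∀ x ∈ C.erase y, ∀ x' ∈ C.erase y, |ℓ x - ℓ x'| ≤ γ / d) →
        (∀ x ∈ C.erase y, ℓ x ≤ -γ) →
        ℓ y ≤ -γ / 2) := by
  letI : DecidableEq (EuclideanSpace ℝ (Fin d)) := Classical.decEq _
  have hd' : (1 : ℝ) ≤ d := by exact_mod_cast hd
  have hlog : 1 ≤ Real.logb 2 ((d : ℝ) + 1) := by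
    rw [Real.le_logb_iff_rpow_le one_lt_two (by linarith), Real.rpow_one]
    linarith
  have hcard' : d + 2 ≤ C.card := by
    have h : (d : ℝ) + 1 < C.card := by nlinarith
    exact_mod_cast h
  obtain ⟨T, hTC, hT⟩ := Finset.exists_subset_card_eq hcard'
  obtain ⟨f, hfx, hf, w, hw, hfw⟩ :=
    Module.exists_nontrivial_relation_sum_zero_of_finrank_succ_lt_card (R := ℝ) (t := T)
      (by rw [finrank_euclideanSpace_fin, hT]; omega)
  obtain ⟨y, hy, hmax⟩ := T.exists_max_image (fun x => |f x|) ⟨w, hw⟩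
  have hfy : f y ≠ 0 := abs_pos.1 ((abs_pos.2 hfw).trans_le (hmax w hw))
  have hsub : ∀ x ∈ T.erase y, x ∈ C.erase y := fun x hx =>
    Finset.mem_erase.2 ⟨Finset.ne_of_mem_erase hx, hTC (Finset.mem_of_mem_erase hx)⟩
  have hcardE : ((T.erase y).card : ℝ) = d + 1 := by
    rw [Finset.card_erase_of_mem hy, hT]; push_cast [Nat.add_sub_cancel]; ring
  have key : ∀ ℓ : EuclideanSpace ℝ (Fin d) →ᵃ[ℝ] ℝ,
      (∀ x ∈ C.erase y, ∀ x' ∈ C.erase y, |ℓ x - ℓ x'| ≤ γ / d) →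
      (∀ x ∈ C.erase y, γ ≤ ℓ x) → γ / 2 ≤ ℓ y := by
    intro ℓ hosc hγℓ
    have hℓ := ℓ.sum_mul_eq_zero_of_affine_dependence hfx hf
    rw [← Finset.add_sum_erase T _ hy] at hf hℓ
    have h := Finset.sub_le_sum_mul_of_abs_le_one (S := T.erase y) (a := fun x => -f x / f y)
      (fun x hx => by
        rw [abs_div, abs_neg]
        exact div_le_one_of_le₀ (hmax x (Finset.mem_of_mem_erase hx)) (abs_nonneg _))
      (by
        rw [← Finset.sum_div, Finset.sum_neg_distrib, div_eq_one_iff_eq hfy]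
        linarith)
      (fun x hx x' hx' => hosc x (hsub x hx) x' (hsub x' hx'))
      (fun x hx => hγℓ x (hsub x hx))
    have hval : ∑ x ∈ T.erase y, -f x / f y * ℓ x = ℓ y := by
      simp_rw [div_mul_eq_mul_div, neg_mul]
      rw [← Finset.sum_div, Finset.sum_neg_distrib, div_eq_iff hfy]
      linarith
    rw [hval, hcardE, add_sub_cancel_right, mul_div_cancel₀ γ (by linarith)] at h
    linarith
  refine ⟨y, hTC hy, key, fun ℓ hosc hγℓ => ?_⟩
  have h := key (-ℓ)
    (fun x hx x' hx' => by
      simpa only [AffineMap.coe_neg, Pi.neg_apply, neg_sub_neg] using hosc x' hx' x hx)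
    (fun x hx => by
      simpa only [AffineMap.coe_neg, Pi.neg_apply] using le_neg_of_le_neg (hγℓ x hx))
  simp only [AffineMap.coe_neg, Pi.neg_apply] at h
  linarith
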